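/- Let G be a simple graph on a finite vertex type V having at least one edge, and define the evolution (graphicable) multiplication on functions x, y : V → ℚ by (x ⋆ y)(j) = Σ_{i adjacent to j in G} x(i)·y(i). Then ⋆ is not associative: there exist x, y, z : V → ℚ with (x ⋆ y) ⋆ z ≠ x ⋆ (y ⋆ z). (In particular, graphicable algebras are non-associative in general.) -/

import Mathlib

open Finset

/-- Let `G` be a simple graph on a finite vertex type `V` having at least one edge,
and let `mul` be the evolution (graphicable) multiplication on functions `V → ℚ`:
`(x ⋆ y) j = ∑_{i adjacent to j in G} x i * y i`. Then `mul` is not associative: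
there exist `x`, `y`, `z` with `(x ⋆ y) ⋆ z ≠ x ⋆ (y ⋆ z)`. -/
theorem graphicable_mul_not_associative {V : Type*} [Fintype V] (G : SimpleGraph V)
    [DecidableRel G.Adj] (hE : ∃ u v : V, G.Adj u v)
    (mul : (V → ℚ) → (V → ℚ) → (V → ℚ))
    (hmul : ∀ x y : V → ℚ, ∀ j : V, mul x y j = ∑ i ∈ G.neighborFinset j, x i * y i) :
    ∃ x y z : V → ℚ, mul (mul x y) z ≠ mul x (mul y z) := by
  classical
  obtain ⟨u, v, huv⟩ := hE
  refine ⟨Pi.single u 1, Pi.single u 1, Pi.single v 1, fun h => ?_⟩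
  have hzero : mul (Pi.single u 1) (Pi.single v 1) = 0 := by
    funext j
    rw [hmul]
    refine Finset.sum_eq_zero fun i _ => ?_
    by_cases hi : i = u
    · subst hi
      simp [huv.ne]
    · simp [Pi.single_apply, hi]
  have hone : mul (Pi.single u 1) (Pi.single u 1) v = 1 := by
    simp [hmul, Pi.single_apply, huv.symm]
  have hu := congrFun h u
  rw [hzero, hmul, hmul] at hu
  simp [Pi.single_apply, huv, hone] at hu
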